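/- arXiv:2508.02108 — 2 statements merged into one kernel-verified Lean document; each statement's English description precedes it below -/
import Mathlib

section
/- Let D be a Hamiltonian-path digraph on {1, …, m}. Then for every vertex v ∈ {1, …, m}, μ_D(v) = 1 + Σ μ_D(src(e)), where the sum ranges over all arcs e of D with tgt(e) ≤ v. -/
/-- A finite directed multigraph with vertex set `Fin m` and edge set `Fin q`,
given by source and target maps. -/
structure Multigraph (m q : ℕ) where
  src : Fin q → Fin m
  tgt : Fin q → Fin m

namespace Multigraph

variable {m q : ℕ}

/-- `p` is a directed path from `u` to `v`: a nonempty list of edges whose first edge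
starts at `u`, whose last edge ends at `v`, and where consecutive edges are composable. -/
def IsPath (D : Multigraph m q) (u v : Fin m) (p : List (Fin q)) : Prop :=
  (∃ e rest, p = e :: rest ∧ D.src e = u) ∧
  (∃ e rest, p = rest ++ [e] ∧ D.tgt e = v) ∧
  p.Chain' (fun a b => D.tgt a = D.src b)

/-- The number of directed paths from `u` to `v` (paths counted as edge sequences). -/
noncomputable def pathCount (D : Multigraph m q) (u v : Fin m) : ℕ :=
  Nat.card {p : List (Fin q) // D.IsPath u v p}

/-- `D` is acyclic: no vertex has a directed path to itself. -/
def Acyclic (D : Multigraph m q) : Prop :=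
  ∀ v : Fin m, ¬ ∃ p, D.IsPath v v p

/-- In-degree of a vertex. -/
def indeg (D : Multigraph m q) (v : Fin m) : ℕ :=
  (Finset.univ.filter (fun e => D.tgt e = v)).card

/-- Out-degree of a vertex. -/
def outdeg (D : Multigraph m q) (v : Fin m) : ℕ :=
  (Finset.univ.filter (fun e => D.src e = v)).card

/-- `D` is 3-regular: every vertex has total degree 3. -/
def ThreeRegular (D : Multigraph m q) : Prop :=
  ∀ v : Fin m, D.indeg v + D.outdeg v = 3

/-- `s` is the unique source (vertex of in-degree 0) of `D`. -/
def UniqueSource (D : Multigraph m q) (s : Fin m) : Prop :=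
  D.indeg s = 0 ∧ ∀ v : Fin m, D.indeg v = 0 → v = s

/-- `t` is the unique sink (vertex of out-degree 0) of `D`. -/
def UniqueSink (D : Multigraph m q) (t : Fin m) : Prop :=
  D.outdeg t = 0 ∧ ∀ v : Fin m, D.outdeg v = 0 → v = t

/-- `μ_D(v)`: the number of directed paths from `s` to `v`, with `μ_D(s) = 1`. -/
noncomputable def mu (D : Multigraph m q) (s v : Fin m) : ℕ :=
  if v = s then 1 else D.pathCount s v

/-- Two vertices are adjacent (disregarding orientation) via an edge in `S`. -/
def Adj (D : Multigraph m q) (S : Set (Fin q)) (a b : Fin m) : Prop :=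
  ∃ e ∈ S, (D.src e = a ∧ D.tgt e = b) ∨ (D.src e = b ∧ D.tgt e = a)

/-- Weak connectivity using only the edges in `S`: any two distinct vertices are joined
by a finite sequence of edges of `S` traversed in either direction. -/
def WeaklyConnectedOn (D : Multigraph m q) (S : Set (Fin q)) : Prop :=
  ∀ a b : Fin m, a ≠ b → Relation.ReflTransGen (D.Adj S) a b

/-- `D` is weakly connected. -/
def WeaklyConnected (D : Multigraph m q) : Prop :=
  D.WeaklyConnectedOn Set.univ

/-- `D` is `ℓ`-edge connected: it has at least two vertices, and deleting any set of at
most `ℓ - 1` edges leaves a weakly connected multigraph. -/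
def EdgeConnected (D : Multigraph m q) (ℓ : ℕ) : Prop :=
  2 ≤ m ∧ ∀ F : Finset (Fin q), F.card ≤ ℓ - 1 → D.WeaklyConnectedOn {e | e ∉ F}

/-- `p` is a directed Hamiltonian path of `D` starting at `u`: a directed path that
visits every vertex exactly once. -/
def IsHamiltonianPath (D : Multigraph m q) (u : Fin m) (p : List (Fin q)) : Prop :=
  (∃ v, D.IsPath u v p) ∧ (u :: p.map D.tgt).Nodup ∧
    ∀ w : Fin m, w ∈ u :: p.map D.tgt

/-- `D` contains a directed Hamiltonian path. -/
def HasHamiltonianPath (D : Multigraph m q) : Prop :=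
  ∃ u p, D.IsHamiltonianPath u p

/-- `D` is simple: no two distinct edges have the same unordered pair of endpoints. -/
def Simple (D : Multigraph m q) : Prop :=
  ∀ e e' : Fin q, e ≠ e' →
    ¬ ((D.src e = D.src e' ∧ D.tgt e = D.tgt e') ∨
       (D.src e = D.tgt e' ∧ D.tgt e = D.src e'))

/-- `D` together with designated edges `H i` (from vertex `i` to vertex `i+1`, 0-based)
is a Hamiltonian-path digraph: the designated edges are pairwise distinct, form the
Hamiltonian path, and every edge goes from a smaller vertex to a larger one.
(Vertices `0, …, m-1` here represent the vertices `1, …, m`.) -/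
def IsHamPathDigraph (D : Multigraph m q) (H : Fin (m - 1) → Fin q) : Prop :=
  Function.Injective H ∧
  (∀ i : Fin (m - 1), (D.src (H i)).val = i.val ∧ (D.tgt (H i)).val = i.val + 1) ∧
  ∀ e : Fin q, (D.src e).val < (D.tgt e).val

end Multigraph

namespace Multigraph

variable {m q : ℕ}

/-- `p` is a possibly empty directed walk from `u` to `v`. -/
def IsWalk (D : Multigraph m q) (u v : Fin m) (p : List (Fin q)) : Prop :=
  (p = [] ∧ v = u) ∨ D.IsPath u v p

theorem not_isPath_nil (D : Multigraph m q) (u v : Fin m) : ¬ D.IsPath u v [] := by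
  rintro ⟨⟨e, r, h, -⟩, -⟩
  simp at h

theorem isPath_iff (D : Multigraph m q) (u v : Fin m) (p : List (Fin q)) :
    D.IsPath u v p ↔ p.head?.map D.src = some u ∧ p.getLast?.map D.tgt = some v ∧
      p.IsChain (fun a b => D.tgt a = D.src b) := by
  refine and_congr ?_ (and_congr ?_ Iff.rfl)
  · cases p <;> simp
  · rcases List.eq_nil_or_concat p with rfl | ⟨r, f, rfl⟩
    · simp
    · simp [List.append_singleton_inj]

theorem isPath_concat_iff (D : Multigraph m q) (u v : Fin m) (r : List (Fin q)) (e : Fin q) :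
    D.IsPath u v (r ++ [e]) ↔ D.tgt e = v ∧ D.IsWalk u (D.src e) r := by
  simp only [IsWalk, isPath_iff, List.isChain_append]
  cases r with
  | nil => simp [and_comm]
  | cons g r =>
    simp [List.getLast?_cons]
    tauto

/-- A directed path to `v` is a last edge into `v` preceded by a walk to its source. -/
noncomputable def pathEquiv (D : Multigraph m q) (u v : Fin m) :
    (Σ e : {e : Fin q // D.tgt e = v}, {r : List (Fin q) // D.IsWalk u (D.src e) r}) ≃
      {p : List (Fin q) // D.IsPath u v p} :=
  Equiv.ofBijective
    (fun x => ⟨x.2.1 ++ [x.1.1], (D.isPath_concat_iff u v _ _).2 ⟨x.1.2, x.2.2⟩⟩) <| by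
    constructor
    · rintro ⟨⟨e, he⟩, ⟨r, hr⟩⟩ ⟨⟨f, hf⟩, ⟨t, ht⟩⟩ h
      obtain ⟨rfl, h'⟩ := List.append_inj' (Subtype.ext_iff.1 h) rfl
      obtain rfl : e = f := by simpa using h'
      rfl
    · rintro ⟨p, hp⟩
      rcases List.eq_nil_or_concat p with rfl | ⟨r, e, rfl⟩
      · exact (D.not_isPath_nil u v hp).elim
      · rw [List.concat_eq_append] at hp
        obtain ⟨he, hr⟩ := (D.isPath_concat_iff u v r e).1 hp
        exact ⟨⟨⟨e, he⟩, ⟨r, hr⟩⟩, Subtype.ext (by simp)⟩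

theorem finite_isWalk (D : Multigraph m q) (hD : ∀ e, D.src e < D.tgt e) (u v : Fin m) :
    Finite {p : List (Fin q) // D.IsWalk u v p} := by
  induction v using WellFoundedLT.induction with
  | ind v ih =>
    have (e : {e : Fin q // D.tgt e = v}) :
        Finite {r : List (Fin q) // D.IsWalk u (D.src e) r} :=
      ih _ ((hD e).trans_eq e.2)
    have hfin : {p : List (Fin q) | D.IsPath u v p}.Finite := Finite.of_equiv _ (D.pathEquiv u v)
    exact (((Set.finite_singleton []).union hfin).subset fun p hp => hp.imp And.left id)

theorem IsPath.lt {D : Multigraph m q} (hD : ∀ e, D.src e < D.tgt e) {u v : Fin m}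
    {p : List (Fin q)} (h : D.IsPath u v p) : u < v := by
  induction p using List.reverseRecOn generalizing v with
  | nil => exact (D.not_isPath_nil u v h).elim
  | append_singleton r e ih =>
    obtain ⟨rfl, ⟨-, hu⟩ | hr⟩ := (D.isPath_concat_iff u v r e).1 h
    · exact hu.symm.trans_lt (hD e)
    · exact (ih hr).trans (hD e)

theorem card_isWalk (D : Multigraph m q) (hD : ∀ e, D.src e < D.tgt e) (u v : Fin m) :
    Nat.card {p : List (Fin q) // D.IsWalk u v p} = D.mu u v := by
  unfold mu
  split_ifs with h
  · subst h
    have (p : List (Fin q)) : D.IsWalk v v p ↔ p = [] :=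
      ⟨fun hp => hp.elim And.left fun hp => (lt_irrefl _ (hp.lt hD)).elim,
        fun hp => Or.inl ⟨hp, rfl⟩⟩
    simp [this]
  · simp [IsWalk, h, pathCount]

theorem mu_eq_sum_tgt_eq (D : Multigraph m q) (hD : ∀ e, D.src e < D.tgt e) {u v : Fin m}
    (h : v ≠ u) :
    D.mu u v = ∑ e ∈ Finset.univ.filter (fun e => D.tgt e = v), D.mu u (D.src e) := by
  have := D.finite_isWalk hD u
  rw [mu, if_neg h, pathCount, ← Nat.card_congr (D.pathEquiv u v), Nat.card_sigma]
  simp only [D.card_isWalk hD]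
  exact (Finset.sum_subtype _ (by simp) fun e => D.mu u (D.src e)).symm

end Multigraph

/-- In a Hamiltonian-path digraph on `{1, …, m}` (0-based `Fin m`, with
source the vertex `0`), for every vertex `v`,
`μ_D(v) = 1 + Σ μ_D(src e)` over all arcs `e` with `tgt e ≤ v`. -/
theorem mu_eq_one_add_sum_arcs (m q : ℕ) (hm : 1 ≤ m) (D : Multigraph m q)
    (H : Fin (m - 1) → Fin q) (hD : D.IsHamPathDigraph H) (v : Fin m) :
    D.mu ⟨0, by omega⟩ v =
      1 + ∑ e ∈ Finset.univ.filter
            (fun e : Fin q => (∀ i, H i ≠ e) ∧ (D.tgt e).val ≤ v.val),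
          D.mu ⟨0, by omega⟩ (D.src e) := by
  obtain ⟨hinj, hH, hlt⟩ := hD
  obtain ⟨n, hn⟩ := v
  induction n with
  | zero =>
    rw [Finset.filter_false_of_mem]
    · simp [Multigraph.mu]
    · rintro e - ⟨-, he⟩
      exact absurd (hlt e) (by simp at he; omega)
  | succ n ih =>
    have hsrc : D.src (H ⟨n, by omega⟩) = ⟨n, by omega⟩ := Fin.ext (hH _).1
    have htgt : D.tgt (H ⟨n, by omega⟩) = ⟨n + 1, hn⟩ := Fin.ext (hH _).2
    have hinto : Finset.univ.filter (fun e : Fin q => D.tgt e = ⟨n + 1, hn⟩) =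
        insert (H ⟨n, by omega⟩) (Finset.univ.filter
          (fun e : Fin q => (∀ i, H i ≠ e) ∧ D.tgt e = ⟨n + 1, hn⟩)) := by
      ext e
      simp only [Finset.mem_filter, Finset.mem_univ, true_and, Finset.mem_insert]
      constructor
      · intro he
        by_cases hi : ∃ i, H i = e
        · obtain ⟨i, rfl⟩ := hi
          left
          congr 1
          have h := (hH i).2
          rw [he] at h
          exact Fin.ext (by simp at h ⊢; omega)
        · exact Or.inr ⟨by simpa using hi, he⟩
      · rintro (rfl | ⟨-, he⟩)
        exacts [htgt, he]
    have harcs : Finset.univ.filter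
          (fun e : Fin q => (∀ i, H i ≠ e) ∧ (D.tgt e).val ≤ n + 1) =
        Finset.univ.filter (fun e : Fin q => (∀ i, H i ≠ e) ∧ (D.tgt e).val ≤ n) ∪
        Finset.univ.filter (fun e : Fin q => (∀ i, H i ≠ e) ∧ D.tgt e = ⟨n + 1, hn⟩) := by
      ext e
      simp only [Finset.mem_filter, Finset.mem_univ, true_and, Finset.mem_union, Fin.ext_iff,
        ← and_or_left, Nat.le_succ_iff]
    rw [D.mu_eq_sum_tgt_eq hlt (by simp), hinto, Finset.sum_insert (by simp), hsrc,
      ih (by omega), harcs, Finset.sum_union, add_assoc]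
    rw [Finset.disjoint_filter]
    rintro e - ⟨-, h⟩ ⟨-, h'⟩
    simp [h'] at h
end

section
/- Let D be a 3-regular Hamiltonian-path digraph on {1, …, m} with m ≥ 2. Then D is NOT 2-edge connected if and only if there exists k with 1 ≤ k < m such that #{v ∈ {1,…,k} : indeg(v) = 2} ≥ #{v ∈ {1,…,k} : outdeg(v) = 2} + 2. -/
namespace Multigraph

variable {m q : ℕ}

/-- The edges of `D` crossing from the first `k` vertices to the remaining ones. -/
def cut (D : Multigraph m q) (k : ℕ) : Finset (Fin q) :=
  Finset.univ.filter (fun e => (D.src e).val < k ∧ k ≤ (D.tgt e).val)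

theorem card_filter_map_lt (f : Fin q → Fin m) (k : ℕ) :
    (Finset.univ.filter (fun e => (f e).val < k)).card =
      ∑ v ∈ Finset.univ.filter (fun v : Fin m => v.val < k),
        (Finset.univ.filter (fun e => f e = v)).card := by
  rw [Finset.card_eq_sum_card_fiberwise (f := f)
    (t := Finset.univ.filter (fun v : Fin m => v.val < k)) (by intro e; simp)]
  refine Finset.sum_congr rfl fun v hv => congrArg Finset.card ?_
  ext e
  simp only [Finset.mem_filter, Finset.mem_univ, true_and] at hv ⊢
  constructor
  · exact And.right
  · rintro rfl
    exact ⟨hv, rfl⟩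

theorem sum_outdeg_eq (D : Multigraph m q) (hlt : ∀ e, (D.src e).val < (D.tgt e).val) (k : ℕ) :
    ∑ v ∈ Finset.univ.filter (fun v : Fin m => v.val < k), D.outdeg v =
      ∑ v ∈ Finset.univ.filter (fun v : Fin m => v.val < k), D.indeg v + (D.cut k).card := by
  simp only [outdeg, indeg, ← card_filter_map_lt]
  rw [cut, ← Finset.card_union_of_disjoint]
  · congr 1
    ext e
    have := hlt e
    simp only [Finset.mem_filter, Finset.mem_univ, true_and, Finset.mem_union]
    omega
  · rw [Finset.disjoint_left]
    intro e
    simp only [Finset.mem_filter, Finset.mem_univ, true_and]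
    omega

/-- In a 3-regular Hamiltonian-path digraph the size of the cut after `k` vertices is determined
by the numbers of vertices of outdegree 2 and of indegree 2 among the first `k` ones. -/
theorem IsHamPathDigraph.card_cut_add {D : Multigraph m q} {H : Fin (m - 1) → Fin q}
    (hD : D.IsHamPathDigraph H) (hreg : D.ThreeRegular) {k : ℕ} (hk : 1 ≤ k) (hkm : k < m) :
    (D.cut k).card +
        (Finset.univ.filter (fun v : Fin m => v.val < k ∧ D.indeg v = 2)).card =
      (Finset.univ.filter (fun v : Fin m => v.val < k ∧ D.outdeg v = 2)).card + 3 := by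
  obtain ⟨-, hH, hlt⟩ := hD
  have hm : 0 < m := by omega
  have indeg_zero : D.indeg ⟨0, hm⟩ = 0 := by
    rw [indeg, Finset.card_eq_zero, Finset.filter_eq_empty_iff]
    intro e _ he
    have := hlt e
    rw [he] at this
    exact Nat.not_lt_zero _ this
  have indeg_pos : ∀ v : Fin m, v.val ≠ 0 → 0 < D.indeg v := by
    intro v hv
    refine Finset.card_pos.2 ⟨H ⟨v.val - 1, by omega⟩, ?_⟩
    have := (hH ⟨v.val - 1, by omega⟩).2
    simp only [Finset.mem_filter, Finset.mem_univ, true_and, Fin.ext_iff]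
    simp only at this
    omega
  have outdeg_pos : ∀ v : Fin m, v.val < k → 0 < D.outdeg v := by
    intro v hv
    refine Finset.card_pos.2 ⟨H ⟨v.val, by omega⟩, ?_⟩
    have := (hH ⟨v.val, by omega⟩).1
    simp only [Finset.mem_filter, Finset.mem_univ, true_and, Fin.ext_iff]
    exact this
  have key : ∀ v ∈ Finset.univ.filter (fun v : Fin m => v.val < k),
      D.outdeg v + (if D.indeg v = 2 then 1 else 0) =
        D.indeg v + (if D.outdeg v = 2 then 1 else 0) +
          (if v = ⟨0, hm⟩ then 3 else 0) := by
    intro v hv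
    simp only [Finset.mem_filter, Finset.mem_univ, true_and] at hv
    have h3 := hreg v
    have ho := outdeg_pos v hv
    by_cases h0 : v = ⟨0, hm⟩
    · subst h0
      simp [indeg_zero] at h3 ⊢
      simp [h3]
    · have hi := indeg_pos v (fun h => h0 (Fin.ext h))
      rw [if_neg h0]
      split_ifs <;> omega
  have hsum := Finset.sum_congr rfl key
  simp only [Finset.sum_add_distrib] at hsum
  rw [sum_outdeg_eq D hlt k, ← Finset.card_filter, ← Finset.card_filter,
    Finset.filter_filter, Finset.filter_filter, Finset.sum_ite_eq',
    if_pos (by simp; omega)] at hsum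
  omega

theorem Adj.symm {D : Multigraph m q} {S : Set (Fin q)} {a b : Fin m} (h : D.Adj S a b) :
    D.Adj S b a := by
  obtain ⟨e, he, h⟩ := h
  exact ⟨e, he, h.symm⟩

theorem reflTransGen_adj_symm {D : Multigraph m q} {S : Set (Fin q)} {a b : Fin m}
    (h : Relation.ReflTransGen (D.Adj S) a b) : Relation.ReflTransGen (D.Adj S) b a :=
  have : Std.Symm (D.Adj S) := ⟨fun _ _ => Adj.symm⟩
  Relation.ReflTransGen.stdSymm.symm _ _ h

theorem reflTransGen_adj_of_consecutive {D : Multigraph m q} {S : Set (Fin q)} {a b : ℕ}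
    (hab : a ≤ b) (hb : b < m)
    (h : ∀ i (hi : i + 1 < m), a ≤ i → i < b →
      Relation.ReflTransGen (D.Adj S) ⟨i, by omega⟩ ⟨i + 1, hi⟩) :
    Relation.ReflTransGen (D.Adj S) ⟨a, by omega⟩ ⟨b, hb⟩ := by
  induction b, hab using Nat.le_induction with
  | base => exact .refl
  | succ n hn ih =>
    exact (ih (by omega) fun i hi h1 h2 => h i hi h1 (by omega)).trans (h n hb hn (by omega))

/-- Deleting a whole cut after `k` vertices disconnects the multigraph. -/
theorem not_weaklyConnectedOn_compl_cut (D : Multigraph m q)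
    (hlt : ∀ e, (D.src e).val < (D.tgt e).val) {k : ℕ} (hk : 1 ≤ k) (hkm : k < m) :
    ¬ D.WeaklyConnectedOn {e | e ∉ D.cut k} := by
  intro h
  have hpath := h ⟨0, by omega⟩ ⟨k, hkm⟩ (by simp [Fin.ext_iff]; omega)
  have inv : ∀ b : Fin m,
      Relation.ReflTransGen (D.Adj {e | e ∉ D.cut k}) ⟨0, by omega⟩ b → b.val < k := by
    intro b hb
    induction hb with
    | refl => exact hk
    | tail _ hadj ih =>
      obtain ⟨e, he, h⟩ := hadj
      have := hlt e
      simp only [cut, Set.mem_ofPred_eq, Finset.mem_filter, Finset.mem_univ, true_and] at he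
      rcases h with ⟨h1, h2⟩ | ⟨h1, h2⟩ <;> rw [h1, h2] at this he <;> omega
  exact lt_irrefl _ (inv _ hpath)

/-- If all cuts of a Hamiltonian-path digraph have at least two edges, then deleting at most one
edge leaves it weakly connected. -/
theorem IsHamPathDigraph.weaklyConnectedOn_compl {D : Multigraph m q} {H : Fin (m - 1) → Fin q}
    (hD : D.IsHamPathDigraph H) (hcut : ∀ k, 1 ≤ k → k < m → 2 ≤ (D.cut k).card)
    {F : Finset (Fin q)} (hF : F.card ≤ 1) : D.WeaklyConnectedOn {e | e ∉ F} := by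
  obtain ⟨hinj, hH, -⟩ := hD
  have step : ∀ i (hi : i + 1 < m), H ⟨i, by omega⟩ ∉ F →
      Relation.ReflTransGen (D.Adj {e | e ∉ F}) ⟨i, by omega⟩ ⟨i + 1, hi⟩ := by
    intro i hi hiF
    obtain ⟨h1, h2⟩ := hH ⟨i, by omega⟩
    exact .single ⟨_, hiF, .inl ⟨Fin.ext h1, Fin.ext h2⟩⟩
  have step' : ∀ i (hi : i + 1 < m),
      Relation.ReflTransGen (D.Adj {e | e ∉ F}) ⟨i, by omega⟩ ⟨i + 1, hi⟩ := by
    intro i hi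
    by_cases hiF : H ⟨i, by omega⟩ ∈ F
    · have other : ∀ j (hj : j + 1 < m), j ≠ i → H ⟨j, by omega⟩ ∉ F := by
        intro j hj hji hjF
        have := hinj (Finset.card_le_one.1 hF _ hjF _ hiF)
        exact hji (congrArg Fin.val this)
      obtain ⟨e, he, heF⟩ :=
        Finset.exists_mem_notMem_of_card_lt_card (hF.trans_lt (hcut (i + 1) (by omega) hi))
      simp only [cut, Finset.mem_filter, Finset.mem_univ, true_and] at he
      have left := reflTransGen_adj_of_consecutive (D := D) (S := {e | e ∉ F})
        (Nat.lt_succ_iff.1 he.1) (by omega)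
        fun j hj _ h2 => step j hj (other j hj (by omega))
      have right := reflTransGen_adj_of_consecutive (D := D) (S := {e | e ∉ F})
        he.2 (D.tgt e).isLt
        fun j hj h1 _ => step j hj (other j hj (by omega))
      exact (reflTransGen_adj_symm left).trans
        (.head ⟨e, heF, .inl ⟨rfl, rfl⟩⟩ (reflTransGen_adj_symm right))
    · exact step i hi hiF
  intro a b _
  rcases le_total a.val b.val with hab | hab
  · exact reflTransGen_adj_of_consecutive hab b.isLt fun i hi _ _ => step' i hi
  · exact reflTransGen_adj_symm
      (reflTransGen_adj_of_consecutive hab a.isLt fun i hi _ _ => step' i hi)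

end Multigraph

/-- A 3-regular Hamiltonian-path digraph on `{1, …, m}` (0-based `Fin m`)
is NOT 2-edge connected if and only if some initial segment `{1, …, k}` contains at least
two more vertices of indegree 2 than vertices of outdegree 2. -/
theorem not_twoEdgeConnected_iff (m q : ℕ) (hm : 2 ≤ m) (D : Multigraph m q)
    (H : Fin (m - 1) → Fin q) (hD : D.IsHamPathDigraph H) (hreg : D.ThreeRegular) :
    ¬ D.EdgeConnected 2 ↔
      ∃ k : ℕ, 1 ≤ k ∧ k < m ∧
        (Finset.univ.filter (fun v : Fin m => v.val < k ∧ D.outdeg v = 2)).card + 2 ≤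
        (Finset.univ.filter (fun v : Fin m => v.val < k ∧ D.indeg v = 2)).card := by
  constructor
  · intro hnot
    by_contra! hall
    refine hnot ⟨hm, fun F hF => hD.weaklyConnectedOn_compl (fun k hk hkm => ?_) hF⟩
    have := hD.card_cut_add hreg hk hkm
    have := hall k hk hkm
    omega
  · rintro ⟨k, hk, hkm, hle⟩ hconn
    have := hD.card_cut_add hreg hk hkm
    exact D.not_weaklyConnectedOn_compl_cut hD.2.2 hk hkm (hconn.2 (D.cut k) (by omega))
end
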